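/- arXiv:2604.22141 — 5 statements merged into one kernel-verified Lean document; each statement's English description precedes it below -/
import Mathlib

section
/- Let N ≥ 1, m ≥ 1, let λ_1 ≥ λ_2 ≥ … ≥ λ_m ≥ 0 be integers, and let c_1,…,c_m ≥ 0 with c_1 + ⋯ + c_m = N. Then in F = ℚ(z_1,…,z_N) one has s_{(λ_1^{c_1}, λ_2^{c_2}, …, λ_m^{c_m})}(z_1,…,z_N) = Σ over all ordered decompositions (C_1,…,C_m) of {1,…,N} with |C_k| = c_k of [∏_{1≤j<k≤m} (1 − z_{C_k}/z_{C_j})^{-1}] · ∏_{k=1}^m z_{C_k}^{λ_k}. -/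
open scoped BigOperators

noncomputable section

/-- `F N` is the field `ℚ(z_1, …, z_N)` of rational functions in `N` variables. -/
abbrev F (N : ℕ) := FractionRing (MvPolynomial (Fin N) ℚ)

/-- The variable `z_a` viewed inside `F N`. -/
noncomputable def z {N : ℕ} (a : Fin N) : F N :=
  algebraMap (MvPolynomial (Fin N) ℚ) (F N) (MvPolynomial.X a)

/-- `z_A^p := ∏_{a ∈ A} z_a^p`. -/
noncomputable def zpowProd {N : ℕ} (A : Finset (Fin N)) (p : ℤ) : F N :=
  ∏ a ∈ A, z a ^ p

/-- `1 − z_A/z_B := ∏_{a∈A} ∏_{b∈B} (1 − z_a/z_b)`. -/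
noncomputable def oneSub {N : ℕ} (A B : Finset (Fin N)) : F N :=
  ∏ a ∈ A, ∏ b ∈ B, (1 - z a / z b)

/-- `z_A − z_B := ∏_{a∈A} ∏_{b∈B} (z_a − z_b)`. -/
noncomputable def zsub {N : ℕ} (A B : Finset (Fin N)) : F N :=
  ∏ a ∈ A, ∏ b ∈ B, (z a - z b)

/-- Read an exponent sequence off a list, padding with `0`. -/
def padded (L : List ℤ) : ℕ → ℤ := fun t => L.getD t 0

/-- The Schur polynomial (bialternant form) associated with the index set
`A ⊆ {1,…,N}` (with its increasing enumeration) and the exponent sequence `lam`. -/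
noncomputable def schur {N : ℕ} (A : Finset (Fin N)) (lam : ℕ → ℤ) : F N :=
  Matrix.det (Matrix.of fun i j : Fin A.card =>
      z ((A.orderIsoOfFin rfl i : Fin N)) ^ (lam j + (A.card : ℤ) - 1 - (j : ℤ)))
    / Matrix.det (Matrix.of fun i j : Fin A.card =>
      z ((A.orderIsoOfFin rfl i : Fin N)) ^ ((A.card : ℤ) - 1 - (j : ℤ)))

section

open Finset

lemma det_pow_card_Ioi {ι R : Type*} [Fintype ι] [LinearOrder ι] [LocallyFiniteOrderTop ι]
    [CommRing R] (w : ι → R) :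
    (Matrix.of fun i j : ι => w i ^ #(Ioi j)).det = ∏ i, ∏ j ∈ Ioi i, (w i - w j) := by
  let e : Fin (Fintype.card ι) ≃o ιᵒᵈ := Fintype.orderIsoFinOfCardEq ιᵒᵈ rfl
  let e' : Fin (Fintype.card ι) ≃ ι := e.toEquiv.trans OrderDual.ofDual
  have he (i j) : e' i < e' j ↔ j < i := by
    rw [← e.lt_iff_lt (x := j)]; rfl
  have hIoi (j) : Ioi (e' j) = (Iio j).map e'.toEmbedding := by
    ext x
    obtain ⟨x, rfl⟩ := e'.surjective x
    simp [he]
  rw [← Matrix.det_submatrix_equiv_self e']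
  have : (Matrix.of fun i j : ι => w i ^ #(Ioi j)).submatrix e' e'
      = Matrix.vandermonde (fun i => w (e' i)) := by
    ext i j
    simp [Matrix.vandermonde, hIoi]
  rw [this, Matrix.det_vandermonde, ← e'.prod_comp]
  simp only [hIoi, prod_map]
  rw [prod_sigma', prod_sigma']
  refine prod_bij' (fun x _ => ⟨x.2, x.1⟩) (fun x _ => ⟨x.2, x.1⟩) ?_ ?_ ?_ ?_ ?_ <;> simp

lemma det_block_pow_card_Ioi {ι α R : Type*} [Fintype ι] [LinearOrder ι] [LocallyFiniteOrderTop ι]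
    [Fintype α] [LinearOrder α] [CommRing R] (w : ι → R) (f : ι → α) (hf : Monotone f) :
    (Matrix.of fun i j : ι => if f i = f j then w i ^ #(Ioi j) else 0).det
      = ∏ i, ∏ j ∈ Ioi i, if f i = f j then w i - w j else w i := by
  have hlt {i j} (h : f i < f j) : i < j := hf.reflect_lt h
  rw [Matrix.BlockTriangular.det_fintype (b := f), ← prod_fiberwise (g := f)]
  · refine prod_congr rfl fun a _ => ?_
    have hcard (j : {i // f i = a}) : #(Ioi (j : ι)) = #{l | a < f l} + #(Ioi j) := by
      rw [← card_map (Function.Embedding.subtype _), ← card_union_of_disjoint]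
      · congr 1
        ext x
        obtain ⟨j, rfl⟩ := j
        simp only [mem_Ioi, mem_union, mem_filter, mem_univ, true_and, mem_map,
          Function.Embedding.subtype_apply, Subtype.exists, exists_and_right, exists_eq_right]
        constructor
        · intro h
          rcases (hf h.le).lt_or_eq with h' | h'
          · exact .inl h'
          · exact .inr ⟨h'.symm, h⟩
        · rintro (h | ⟨_, h⟩)
          · exact hlt h
          · exact h
      · rw [disjoint_left]
        intro x hx hx'
        simp at hx hx'
        obtain ⟨h, -⟩ := hx'
        exact hx.ne' h
    have : (Matrix.of fun i j : ι => if f i = f j then w i ^ #(Ioi j) else 0).toSquareBlock f a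
        = Matrix.of fun i j : {i // f i = a} => w i ^ #{l | a < f l} *
          (Matrix.of fun i j : {i // f i = a} => w i ^ #(Ioi j)) i j := by
      ext i j
      simp [Matrix.toSquareBlock_def, i.2, j.2, hcard, pow_add]
    have hdet : (Matrix.of fun i j : {i // f i = a} => w i ^ #(Ioi j)).det
        = ∏ i : {i // f i = a}, ∏ j ∈ Ioi i, (w i - w j) := by
      convert det_pow_card_Ioi (fun i : {i // f i = a} => w i)
    rw [this, Matrix.det_mul_column, hdet, ← prod_mul_distrib,
      prod_subtype (p := fun i => f i = a) _ (by simp)]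
    refine prod_congr rfl fun i _ => ?_
    obtain ⟨i, rfl⟩ := i
    rw [prod_ite, mul_comm]
    congr 1
    · refine (prod_map (Ioi (⟨i, rfl⟩ : {j // f j = f i})) (Function.Embedding.subtype _)
        (fun j => w i - w j)).symm.trans ?_
      congr 1
      ext x
      simp [and_comm, eq_comm]
    · rw [prod_const]
      congr 2
      ext x
      simp only [mem_filter, mem_univ, true_and, mem_Ioi]
      exact ⟨fun h => ⟨hlt h, h.ne⟩, fun h => lt_of_le_of_ne (hf h.1.le) h.2⟩
  · intro i j h
    simp [h.ne']

lemma prod_sub_eq_prod_blocks_mul {ι α K : Type*} [Fintype ι] [LinearOrder ι]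
    [LocallyFiniteOrderTop ι] [Fintype α] [LinearOrder α] [Field K] (w : ι → K)
    (hw : ∀ i, w i ≠ 0) (f : ι → α) (hf : Monotone f) :
    ∏ i, ∏ j ∈ Ioi i, (w i - w j)
      = (∏ i, ∏ j ∈ Ioi i, if f i = f j then w i - w j else w i) *
        ∏ p : α × α with p.1 < p.2, ∏ a with f a = p.2, ∏ b with f b = p.1,
          (1 - w a / w b) := by
  have hblocks : ∏ p : α × α with p.1 < p.2, ∏ a with f a = p.2, ∏ b with f b = p.1,
      (1 - w a / w b) = ∏ x : ι × ι with f x.1 < f x.2, (1 - w x.2 / w x.1) := by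
    rw [← prod_fiberwise_of_maps_to (s := {x : ι × ι | f x.1 < f x.2})
      (t := {p : α × α | p.1 < p.2}) (g := fun x => (f x.1, f x.2)) (by simp)]
    refine prod_congr rfl fun p hp => ?_
    rw [prod_comm, ← prod_product']
    refine prod_congr ?_ fun _ _ => rfl
    ext x
    obtain ⟨p₁, p₂⟩ := p
    simp only [mem_filter, mem_univ, true_and, mem_product, Prod.mk.injEq] at hp ⊢
    constructor
    · rintro ⟨rfl, rfl⟩
      exact ⟨hp, rfl, rfl⟩
    · exact fun h => h.2
  rw [hblocks, prod_filter, Fintype.prod_prod_type, ← prod_mul_distrib]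
  refine prod_congr rfl fun i _ => ?_
  have hIoi : ∏ j, (if f i < f j then 1 - w j / w i else 1)
      = ∏ j ∈ Ioi i, (if f i < f j then 1 - w j / w i else 1) := by
    symm
    refine prod_subset (subset_univ _) fun j _ hj => if_neg fun h => hj ?_
    exact mem_Ioi.2 (hf.reflect_lt h)
  rw [hIoi, ← prod_mul_distrib]
  refine prod_congr rfl fun j hj => ?_
  rcases (hf (mem_Ioi.1 hj).le).eq_or_lt with h | h
  · simp [h]
  · rw [if_neg h.ne, if_pos h, mul_sub, mul_one, mul_div_cancel₀ _ (hw i)]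

/-- The ordered decomposition whose parts are the images under `σ` of the fibres of `f`. -/
def permBlocks {ι α : Type*} [Fintype ι] [DecidableEq α] (f : ι → α) (σ : Equiv.Perm ι) (k : α) :
    Finset ι :=
  ({i | f i = k} : Finset ι).map σ.toEmbedding

lemma mem_permBlocks {ι α : Type*} [Fintype ι] [DecidableEq α] {f : ι → α} {σ : Equiv.Perm ι}
    {k : α} {x : ι} : x ∈ permBlocks f σ k ↔ f (σ.symm x) = k := by
  simp [permBlocks]

lemma permBlocks_mul_eq_iff {ι α : Type*} [Fintype ι] [DecidableEq α] {f : ι → α}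
    {σ τ : Equiv.Perm ι} : permBlocks f (σ * τ) = permBlocks f σ ↔ ∀ i, f (τ i) = f i := by
  constructor
  · intro h i
    have := congrFun h (f i)
    rw [Finset.ext_iff] at this
    simpa [mem_permBlocks, Equiv.Perm.mul_def] using this (σ (τ i))
  · intro h
    ext k x
    have := h (τ.symm (σ.symm x))
    rw [Equiv.apply_symm_apply] at this
    simp [mem_permBlocks, Equiv.Perm.mul_def, this]

lemma sum_permBlocks_eq {ι α K : Type*} [Fintype ι] [LinearOrder ι]
    [LocallyFiniteOrderTop ι] [Fintype α] [LinearOrder α] [Field K] (w : ι → K)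
    (hw : ∀ i, w i ≠ 0) (hinj : Function.Injective w) (f : ι → α) (hf : Monotone f)
    (lam : α → ℤ) (σ : Equiv.Perm ι) :
    ∑ τ : Equiv.Perm ι with permBlocks f τ = permBlocks f σ,
        Equiv.Perm.sign τ • ∏ i, (w (τ i) ^ lam (f i) * w (τ i) ^ #(Ioi i))
      = (Matrix.of fun i j => w i ^ #(Ioi j)).det *
        ((∏ p : α × α with p.1 < p.2, ∏ a ∈ permBlocks f σ p.2, ∏ b ∈ permBlocks f σ p.1,
            (1 - w a / w b))⁻¹ *
          ∏ k, ∏ a ∈ permBlocks f σ k, w a ^ lam k) := by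
  set E := ∏ p : α × α with p.1 < p.2, ∏ a ∈ permBlocks f σ p.2, ∏ b ∈ permBlocks f σ p.1,
    (1 - w a / w b) with hE
  have hE0 : E ≠ 0 := by
    refine prod_ne_zero_iff.2 fun p hp => prod_ne_zero_iff.2 fun a ha =>
      prod_ne_zero_iff.2 fun b hb => ?_
    rw [mem_permBlocks] at ha hb
    rw [sub_ne_zero, ne_comm, Ne, div_eq_one_iff_eq (hw b)]
    intro h
    rw [hinj h, hb] at ha
    exact (mem_filter.1 hp).2.ne ha
  have hmono : ∏ k, ∏ a ∈ permBlocks f σ k, w a ^ lam k = ∏ i, w (σ i) ^ lam (f i) := by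
    rw [← prod_fiberwise univ f]
    refine prod_congr rfl fun k _ => ?_
    rw [permBlocks, prod_map]
    exact prod_congr rfl fun i hi => by rw [(mem_filter.1 hi).2]; rfl
  have hsum : ∑ τ : Equiv.Perm ι with permBlocks f τ = permBlocks f σ,
        Equiv.Perm.sign τ • ∏ i, (w (τ i) ^ lam (f i) * w (τ i) ^ #(Ioi i))
      = (Equiv.Perm.sign σ : ℤ) * (∏ i, w (σ i) ^ lam (f i)) *
        (Matrix.of fun i j : ι => if f i = f j then w (σ i) ^ #(Ioi j) else 0).det := by
    rw [sum_filter, ← Equiv.sum_comp (Equiv.mulLeft σ), Matrix.det_apply, mul_sum]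
    refine sum_congr rfl fun τ _ => ?_
    simp only [Equiv.coe_mulLeft, permBlocks_mul_eq_iff, Matrix.of_apply]
    split_ifs with h
    · simp only [h, if_true, Equiv.Perm.sign_mul, prod_mul_distrib, Equiv.Perm.mul_apply]
      rw [← Equiv.prod_comp τ (fun i => w (σ i) ^ lam (f i))]
      simp only [h, Units.smul_def, zsmul_eq_mul]
      push_cast
      ring
    · push Not at h
      obtain ⟨i, hi⟩ := h
      have hzero : ∏ i, (if f (τ i) = f i then w (σ (τ i)) ^ #(Ioi i) else 0) = 0 :=
        prod_eq_zero (mem_univ i) (if_neg hi)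
      rw [hzero, smul_zero, mul_zero]
  have hdet : (Equiv.Perm.sign σ : ℤ) * (Matrix.of fun i j => w i ^ #(Ioi j)).det
      = (Matrix.of fun i j : ι => if f i = f j then w (σ i) ^ #(Ioi j) else 0).det * E := by
    rw [← Matrix.det_permute, det_block_pow_card_Ioi (fun i => w (σ i)) f hf]
    have := prod_sub_eq_prod_blocks_mul (fun i => w (σ i)) (fun i => hw _) f hf
    rw [← det_pow_card_Ioi] at this
    simp only [hE, permBlocks, prod_map]
    exact this
  have hsign : ((Equiv.Perm.sign σ : ℤ) : K) * (Equiv.Perm.sign σ : ℤ) = 1 := by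
    rw [← Int.cast_mul, ← Units.val_mul, Int.units_mul_self, Units.val_one, Int.cast_one]
  rw [hsum, hmono]
  set d := (Matrix.of fun i j : ι => if f i = f j then w (σ i) ^ #(Ioi j) else 0).det
  rw [← mul_inv_eq_iff_eq_mul₀ hE0] at hdet
  rw [← hdet]
  linear_combination (Matrix.of fun i j => w i ^ #(Ioi j)).det * E⁻¹ *
    (∏ i, w (σ i) ^ lam (f i)) * hsign

lemma permBlocks_card {ι α : Type*} [Fintype ι] [DecidableEq α] (f : ι → α) (σ : Equiv.Perm ι)
    (k : α) : #(permBlocks f σ k) = #{i | f i = k} :=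
  card_map _

lemma exists_permBlocks_eq {ι α : Type*} [Fintype ι] [DecidableEq ι] [Fintype α] [DecidableEq α]
    (f : ι → α) (C : α → Finset ι) (hcard : ∀ k, #(C k) = #{i | f i = k})
    (hdisj : ∀ j k, j ≠ k → Disjoint (C j) (C k)) (hcover : univ.biUnion C = univ) :
    ∃ σ : Equiv.Perm ι, permBlocks f σ = C := by
  have hex (x : ι) : ∃ k, x ∈ C k := by simpa using hcover.ge (mem_univ x)
  choose g hg using hex
  have hmem (x k) : x ∈ C k ↔ g x = k := by
    refine ⟨fun h => ?_, fun h => h ▸ hg x⟩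
    by_contra hne
    exact disjoint_left.1 (hdisj _ _ hne) (hg x) h
  have e (k : α) : Nonempty ({i // f i = k} ≃ {x // g x = k}) := by
    refine ⟨Fintype.equivOfCardEq ?_⟩
    rw [Fintype.card_subtype, Fintype.card_subtype, ← hcard]
    congr 1
    ext x
    simp [hmem]
  refine ⟨Equiv.ofFiberEquiv fun k => (e k).some, ?_⟩
  ext k x
  rw [mem_permBlocks, hmem, ← Equiv.ofFiberEquiv_map (fun k => (e k).some), Equiv.apply_symm_apply]

lemma det_eq_det_mul_sum {ι α K : Type*} [Fintype ι] [LinearOrder ι]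
    [LocallyFiniteOrderTop ι] [Fintype α] [LinearOrder α] [Field K] (w : ι → K)
    (hw : ∀ i, w i ≠ 0) (hinj : Function.Injective w) (f : ι → α) (hf : Monotone f)
    (lam : α → ℤ) :
    (Matrix.of fun i j => w i ^ lam (f j) * w i ^ #(Ioi j)).det
      = (Matrix.of fun i j => w i ^ #(Ioi j)).det *
        ∑ C : α → Finset ι with (∀ k, #(C k) = #{i | f i = k}) ∧
            (∀ j k, j ≠ k → Disjoint (C j) (C k)) ∧ univ.biUnion C = univ,
          ((∏ p : α × α with p.1 < p.2, ∏ a ∈ C p.2, ∏ b ∈ C p.1, (1 - w a / w b))⁻¹ *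
            ∏ k, ∏ a ∈ C k, w a ^ lam k) := by
  rw [Matrix.det_apply, mul_sum, ← sum_fiberwise_of_maps_to (g := permBlocks f)]
  · refine sum_congr rfl fun C hC => ?_
    obtain ⟨hcard, hdisj, hcover⟩ := (mem_filter.1 hC).2
    obtain ⟨σ, rfl⟩ := exists_permBlocks_eq f C hcard hdisj hcover
    exact sum_permBlocks_eq w hw hinj f hf lam σ
  · intro σ _
    refine mem_filter.2 ⟨mem_univ _, permBlocks_card f σ, fun j k hjk => ?_, ?_⟩
    · refine disjoint_left.2 fun x hx hx' => hjk ?_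
      rw [← mem_permBlocks.1 hx, mem_permBlocks.1 hx']
    · ext x
      simp [mem_permBlocks]

lemma exists_monotone_fibers (N m : ℕ) (c : Fin m → ℕ) (hc : ∑ k, c k = N) (lam : Fin m → ℤ) :
    ∃ f : Fin N → Fin m, Monotone f ∧ (∀ k, #{i | f i = k} = c k) ∧
      ∀ i : Fin N, padded (List.ofFn fun k : Fin m => List.replicate (c k) (lam k)).flatten i
        = lam (f i) := by
  set L : List (Fin m) := (List.ofFn fun k : Fin m => List.replicate (c k) k).flatten with hL
  have hlen : L.length = N := by
    simp [hL, List.length_flatten, List.map_ofFn, Function.comp_def, List.sum_ofFn, hc]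
  have hmap : (List.ofFn fun k : Fin m => List.replicate (c k) (lam k)).flatten = L.map lam := by
    simp [hL, List.map_flatten, List.map_ofFn, Function.comp_def]
  have hsorted : L.Pairwise (· ≤ ·) := by
    rw [hL, List.pairwise_flatten]
    refine ⟨?_, ?_⟩
    · intro l hl
      obtain ⟨k, rfl⟩ := (List.mem_ofFn' _ _).1 hl
      simp [List.pairwise_replicate]
    · rw [List.pairwise_ofFn]
      intro i j hij x hx y hy
      rw [List.eq_of_mem_replicate hx, List.eq_of_mem_replicate hy]
      exact hij.le
  have hcount (k : Fin m) : L.count k = c k := by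
    simp [hL, List.count_flatten, List.map_ofFn, Function.comp_def, List.sum_ofFn,
      List.count_replicate]
  clear_value L
  subst hlen
  refine ⟨L.get, hsorted.sortedLE.monotone_get, fun k => ?_, fun i => ?_⟩
  · rw [← hcount k]
    exact Fin.card_filter_univ_eq_vector_get_eq_count k (⟨L, rfl⟩ : List.Vector (Fin m) L.length)
  · simp [hmap, padded]

lemma z_ne_zero {N : ℕ} (a : Fin N) : z a ≠ 0 := by
  rw [z, Ne, IsFractionRing.to_map_eq_zero_iff]
  exact MvPolynomial.X_ne_zero a

lemma z_injective {N : ℕ} : Function.Injective (z : Fin N → F N) :=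
  (IsFractionRing.injective (MvPolynomial (Fin N) ℚ) (F N)).comp (MvPolynomial.X_injective)

lemma det_orderIsoOfFin_univ {N : ℕ} (μ : ℕ → ℤ) :
    (Matrix.of fun i j : Fin (univ : Finset (Fin N)).card =>
      z ((univ.orderIsoOfFin rfl i : Fin N)) ^ (μ j + (#(univ : Finset (Fin N)) : ℤ) - 1 - (j : ℤ))).det
    = (Matrix.of fun i j : Fin N => z i ^ μ j * z i ^ #(Ioi j)).det := by
  have hcard : #(univ : Finset (Fin N)) = N := by simp
  have hval (i) : ((univ.orderIsoOfFin rfl i : Fin N)) = finCongr hcard i := by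
    have : (univ : Finset (Fin N)).orderEmbOfFin rfl
        = (Fin.castOrderIso hcard).toOrderEmbedding := by
      symm
      apply orderEmbOfFin_unique'
      simp
    rw [coe_orderIsoOfFin_apply, this]
    rfl
  rw [← Matrix.det_submatrix_equiv_self (finCongr hcard)]
  congr 1
  ext i j
  simp only [Matrix.of_apply, Matrix.submatrix_apply, hval, Fin.card_Ioi]
  rw [← zpow_natCast, ← zpow_add₀ (z_ne_zero _)]
  congr 1
  have := j.2
  simp only [finCongr_apply, Fin.val_cast]
  omega

end

open Classical in
/-- the symmetrization formula expressing the Schur polynomial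
`s_{(λ_1^{c_1},…,λ_m^{c_m})}(z_1,…,z_N)` as a sum over ordered decompositions. -/
theorem statement0 (N m : ℕ) (hN : 1 ≤ N) (hm : 1 ≤ m)
    (lam : Fin m → ℤ) (hanti : ∀ j k : Fin m, j ≤ k → lam k ≤ lam j)
    (hpos : ∀ j, 0 ≤ lam j)
    (c : Fin m → ℕ) (hc : ∑ k, c k = N) :
    schur (Finset.univ : Finset (Fin N))
        (padded (List.ofFn fun k : Fin m => List.replicate (c k) (lam k)).flatten)
      = ∑ C ∈ Finset.univ.filter (fun C : Fin m → Finset (Fin N) =>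
            (∀ k, (C k).card = c k) ∧ (∀ j k, j ≠ k → Disjoint (C j) (C k)) ∧
            Finset.univ.biUnion C = Finset.univ),
          (∏ p ∈ Finset.univ.filter (fun p : Fin m × Fin m => p.1 < p.2),
              oneSub (C p.2) (C p.1))⁻¹ *
            ∏ k, zpowProd (C k) (lam k) := by
  obtain ⟨f, hf, hfib, hlam⟩ := exists_monotone_fibers N m c hc lam
  have hdet := det_eq_det_mul_sum z z_ne_zero z_injective f hf lam
  have hvand : (Matrix.of fun i j : Fin N => z i ^ (Finset.Ioi j).card).det ≠ 0 := by
    rw [det_pow_card_Ioi]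
    refine Finset.prod_ne_zero_iff.2 fun i _ => Finset.prod_ne_zero_iff.2 fun j hj => ?_
    exact sub_ne_zero.2 fun h => (Finset.mem_Ioi.1 hj).ne (z_injective h)
  have hzero := det_orderIsoOfFin_univ (N := N) 0
  simp only [Pi.zero_apply, zero_add, zpow_zero, one_mul] at hzero
  rw [schur, det_orderIsoOfFin_univ, hzero, div_eq_iff hvand, mul_comm]
  simp only [hlam, hdet, hfib]
  rfl

end
end

section
/- Let k_1, k_2 ≥ 0 and let m_{2,1} > m_{2,2} > … > m_{2,k_2} > m_{1,1} > m_{1,2} > … > m_{1,k_1} ≥ 0 be integers. Let pairwise disjoint subsets Z_{1,1},…,Z_{1,k_1}, Z_{2,1},…,Z_{2,k_2} form an ordered decomposition of {1,…,N}, and set Z_1 := Z_{1,1} ∪ … ∪ Z_{1,k_1} and Z_2 := Z_{2,1} ∪ … ∪ Z_{2,k_2}. Then in F = ℚ(z_1,…,z_N): s_{((m_{2,1}−k_1−k_2+1)^{|Z_{2,1}|}, …, (m_{2,k_2}−k_1)^{|Z_{2,k_2}|}, (m_{1,1}−k_1+1)^{|Z_{1,1}|}, …, m_{1,k_1}^{|Z_{1,k_1}|})}(z_1,…,z_N)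 = Σ over all ordered decompositions (W_1, W_2) of {1,…,N} with |W_1| = |Z_1| and |W_2| = |Z_2| of [1/(z_{W_2} − z_{W_1})] · s_{((m_{1,1}−k_1+1)^{|Z_{1,1}|}, (m_{1,2}−k_1+2)^{|Z_{1,2}|}, …, m_{1,k_1}^{|Z_{1,k_1}|})}(z_{W_1}) · s_{((m_{2,1}+|Z_1|−k_1−k_2+1)^{|Z_{2,1}|}, (m_{2,2}+|Z_1|−k_1−k_2+2)^{|Z_{2,2}|}, …, (m_{2,k_2}+|Z_1|−k_1)^{|Z_{2,k_2}|})}(z_{W_2}). -/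
open scoped BigOperators

noncomputable section

open Matrix in
/-- Independently reindexing the rows and columns changes the determinant by a unit
that does not depend on the matrix. -/
lemma det_submatrix_equiv_equiv {m n R : Type*} [CommRing R] [Fintype m] [DecidableEq m]
    [Fintype n] [DecidableEq n] (g e : m ≃ n) (M : Matrix n n R) :
    (M.submatrix g e).det = (Equiv.Perm.sign (e.symm.trans g) : ℤ) * M.det := by
  rw [← Matrix.det_permute, ← Matrix.det_submatrix_equiv_self e]
  congr 1
  ext i j
  simp

/-- The Schur quotient may be computed with any enumeration of the index set. -/
lemma schur_eq_of_enum {N n : ℕ} (A : Finset (Fin N)) (hA : A.card = n) (f : Fin n ≃ A)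
    (lam : ℕ → ℤ) :
    schur A lam = Matrix.det (Matrix.of fun i j : Fin n =>
        z (f i : Fin N) ^ (lam j + (n : ℤ) - 1 - (j : ℤ)))
      / Matrix.det (Matrix.of fun i j : Fin n => z (f i : Fin N) ^ ((n : ℤ) - 1 - (j : ℤ))) := by
  subst hA
  set o := (A.orderIsoOfFin rfl).toEquiv
  have key (c : Fin A.card → ℤ) :
      Matrix.det (Matrix.of fun i j : Fin A.card => z (f i : Fin N) ^ c j) =
        (Equiv.Perm.sign (f.trans o.symm) : ℤ) *
          Matrix.det (Matrix.of fun i j : Fin A.card => z (o i : Fin N) ^ c j) := by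
    rw [← Matrix.det_permute]
    congr 1
    ext i j
    simp
  rw [key, key, mul_div_mul_left]
  · rfl
  · rcases Int.units_eq_one_or (Equiv.Perm.sign (f.trans o.symm)) with h | h <;> simp [h]

/-- The Vandermonde determinant with decreasing exponents, as a product of differences. -/
lemma det_zpow_rev {K : Type*} [Field K] {n : ℕ} (x : Fin n → K) :
    Matrix.det (Matrix.of fun i j : Fin n => x i ^ ((n : ℤ) - 1 - (j : ℤ))) =
      ∏ i, ∏ j ∈ Finset.Ioi i, (x i - x j) := by
  have h := Matrix.det_projVandermonde (fun _ : Fin n => (1 : K)) x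
  simp only [one_mul] at h
  rw [← h]
  congr 1
  ext i j
  simp only [Matrix.of_apply, Matrix.projVandermonde_apply, one_pow, one_mul]
  rw [← zpow_natCast]
  congr 1
  have := j.isLt
  rw [Fin.val_rev]
  omega

/-- Splitting a product over pairs `i < j` of `Fin (b + a)` into blocks. -/
lemma prod_Ioi_add {K : Type*} [CommMonoid K] {a b : ℕ} (f : Fin (b + a) → Fin (b + a) → K) :
    ∏ i, ∏ j ∈ Finset.Ioi i, f i j =
      (∏ i : Fin b, ∏ j ∈ Finset.Ioi i, f (Fin.castAdd a i) (Fin.castAdd a j)) *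
        (∏ i : Fin a, ∏ j ∈ Finset.Ioi i, f (Fin.natAdd b i) (Fin.natAdd b j)) *
        ∏ i : Fin b, ∏ j : Fin a, f (Fin.castAdd a i) (Fin.natAdd b j) := by
  have h (n : ℕ) (i : Fin n) (g : Fin n → K) :
      ∏ j ∈ Finset.Ioi i, g j = ∏ j, if i < j then g j else 1 := by
    rw [← Finset.prod_filter]
    congr 1
    ext j
    simp
  simp only [h, Fin.prod_univ_add]
  have h1 (i : Fin b) (j : Fin a) : Fin.castAdd a i < Fin.natAdd b j := by
    simp only [Fin.lt_def, Fin.val_castAdd, Fin.val_natAdd]; omega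
  have h2 (i : Fin a) (j : Fin b) : ¬ Fin.natAdd b i < Fin.castAdd a j := by
    simp only [Fin.lt_def, Fin.val_castAdd, Fin.val_natAdd]; omega
  have h3 (i j : Fin b) : Fin.castAdd a i < Fin.castAdd a j ↔ i < j := by
    simp only [Fin.lt_def, Fin.val_castAdd]
  have h4 (i j : Fin a) : Fin.natAdd b i < Fin.natAdd b j ↔ i < j := by
    simp only [Fin.lt_def, Fin.val_natAdd]; omega
  simp only [h1, h2, h3, h4, if_true, if_false, Finset.prod_const_one, one_mul,
    Finset.prod_mul_distrib]
  exact mul_right_comm _ _ _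

open Classical in
/-- Laplace expansion along the first `b` columns, each minor product being written as the
determinant of a matrix with two zero blocks. -/
lemma det_eq_sum_det_blocks {R : Type*} [CommRing R] {a b : ℕ}
    (M : Matrix (Fin (b + a)) (Fin (b + a)) R) :
    M.det = ∑ P ∈ Finset.univ.filter
        (fun P : Finset (Fin (b + a)) × Finset (Fin (b + a)) =>
          P.1.card = a ∧ P.2.card = b ∧ Disjoint P.1 P.2 ∧ P.1 ∪ P.2 = Finset.univ),
      Matrix.det (Matrix.of fun i j => if (i ∈ P.2 ↔ (j : ℕ) < b) then M i j else 0) := by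
  simp only [Matrix.det_apply]
  rw [Finset.sum_comm]
  refine Finset.sum_congr rfl fun σ _ => ?_
  rw [← Finset.smul_sum]
  congr 1
  set S : Finset (Fin (b + a)) := Finset.univ.map ((Fin.castAddEmb a).trans σ.toEmbedding)
  have hS (j : Fin (b + a)) : σ j ∈ S ↔ (j : ℕ) < b := by
    simp only [S, Finset.mem_map, Finset.mem_univ, true_and, Function.Embedding.trans_apply,
      Equiv.coe_toEmbedding, EmbeddingLike.apply_eq_iff_eq]
    constructor
    · rintro ⟨i, rfl⟩
      simp
    · intro h
      exact ⟨⟨j, h⟩, by ext; simp⟩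
  rw [Finset.sum_eq_single (Sᶜ, S)]
  · refine Finset.prod_congr rfl fun j _ => ?_
    simp [hS]
  · rintro ⟨P, Q⟩ hP hne
    simp only [Finset.mem_filter, Finset.mem_univ, true_and] at hP
    obtain ⟨-, -, hd, hu⟩ := hP
    have hPQ : P = Qᶜ := by
      rw [eq_compl_iff_isCompl]
      exact ⟨hd, codisjoint_iff.2 hu⟩
    have hQ : Q ≠ S := by
      rintro rfl
      exact hne (by rw [hPQ])
    obtain ⟨i, hi⟩ : ∃ i, ¬ (i ∈ Q ↔ i ∈ S) := by
      by_contra! h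
      exact hQ (Finset.ext h)
    refine Finset.prod_eq_zero (Finset.mem_univ (σ.symm i)) ?_
    rw [Matrix.of_apply, if_neg]
    rwa [← hS, Equiv.apply_symm_apply]
  · intro h
    refine absurd ?_ h
    have hc : S.card = b := by simp [S]
    simp only [Finset.mem_filter, Finset.mem_univ, true_and]
    refine ⟨?_, hc, disjoint_compl_left, by
      rw [Finset.union_comm, Finset.union_compl]⟩
    rw [Finset.card_compl, hc]
    simp

open Classical in
lemma schur_univ_eq_sum {a b N : ℕ} (hN : N = b + a) (mu nu nu' : ℕ → ℤ) (lam : ℕ → ℤ)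
    (hnu : ∀ j < b, lam j = nu j) (hmu : ∀ j < a, lam (b + j) = mu j)
    (hnu' : ∀ j < b, nu' j = nu j + a) :
    schur (Finset.univ : Finset (Fin N)) lam =
      ∑ P ∈ Finset.univ.filter (fun P : Finset (Fin N) × Finset (Fin N) =>
          P.1.card = a ∧ P.2.card = b ∧ Disjoint P.1 P.2 ∧ P.1 ∪ P.2 = Finset.univ),
        (zsub P.2 P.1)⁻¹ * schur P.1 mu * schur P.2 nu' := by
  subst hN
  rw [schur_eq_of_enum Finset.univ (by simp)
    (Equiv.subtypeUnivEquiv (fun i => Finset.mem_univ i)).symm]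
  rw [det_eq_sum_det_blocks, Finset.sum_div]
  refine Finset.sum_congr rfl ?_
  rintro ⟨P, Q⟩ hP
  simp only [Finset.mem_filter, Finset.mem_univ, true_and] at hP
  obtain ⟨hPa, hQb, hd, hu⟩ := hP
  have hPQ (i : Fin (b + a)) : i ∈ P ↔ i ∉ Q := by
    have : P = Qᶜ := by
      rw [eq_compl_iff_isCompl]
      exact ⟨hd, codisjoint_iff.2 hu⟩
    simp [this]
  let p : Fin a ≃ P := (P.orderIsoOfFin hPa).toEquiv
  let q : Fin b ≃ Q := (Q.orderIsoOfFin hQb).toEquiv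
  have hp (i : Fin a) : (p i : Fin (b + a)) ∉ Q := (hPQ _).1 (p i).2
  let g : Fin b ⊕ Fin a ≃ Fin (b + a) :=
    (Equiv.sumCongr q (p.trans (Equiv.subtypeEquivRight hPQ))).trans
      (Equiv.sumCompl (· ∈ Q))
  have hgl (i : Fin b) : g (Sum.inl i) = q i := by simp [g]
  have hgr (i : Fin a) : g (Sum.inr i) = p i := by simp [g]
  rw [schur_eq_of_enum P hPa p, schur_eq_of_enum Q hQb q]
  set s : F (b + a) := ((Equiv.Perm.sign (finSumFinEquiv.symm.trans g) : ℤ) : F (b + a))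
    with hs
  have hs0 : s ≠ 0 := by
    rw [hs]
    rcases Int.units_eq_one_or (Equiv.Perm.sign (finSumFinEquiv.symm.trans g)) with h | h <;>
      simp [h]
  have hz : zsub Q P = ∏ i : Fin b, ∏ j : Fin a, (z (q i : Fin (b + a)) - z (p j)) := by
    rw [zsub, ← Finset.prod_coe_sort, ← q.prod_comp]
    refine Finset.prod_congr rfl fun i _ => ?_
    rw [← Finset.prod_coe_sort, ← p.prod_comp]
  simp only [Equiv.subtypeUnivEquiv_symm_apply, Matrix.of_apply]
  rw [← mul_div_mul_left _ _ hs0, hs, ← det_submatrix_equiv_equiv, ← det_submatrix_equiv_equiv]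
  have hV : (Matrix.submatrix (Matrix.of fun i j : Fin (b + a) =>
      z i ^ (((b + a : ℕ) : ℤ) - 1 - (j : ℤ))) g finSumFinEquiv).det =
      (Matrix.of fun i j : Fin b => z (q i : Fin (b + a)) ^ ((b : ℤ) - 1 - (j : ℤ))).det *
      (Matrix.of fun i j : Fin a => z (p i : Fin (b + a)) ^ ((a : ℤ) - 1 - (j : ℤ))).det *
      zsub Q P := by
    rw [det_zpow_rev, det_zpow_rev, hz, ← Matrix.det_submatrix_equiv_self finSumFinEquiv.symm]
    have := det_zpow_rev (fun i => z (g (finSumFinEquiv.symm i)))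
    rw [prod_Ioi_add] at this
    simp only [finSumFinEquiv_symm_apply_castAdd, finSumFinEquiv_symm_apply_natAdd,
      hgl, hgr] at this
    rw [← this]
    congr 1
    ext i j
    simp
  have hM : (Matrix.submatrix (Matrix.of fun i (j : Fin (b + a)) =>
      if (i ∈ Q ↔ (j : ℕ) < b) then z i ^ (lam j + ((b + a : ℕ) : ℤ) - 1 - (j : ℤ)) else 0)
        g finSumFinEquiv) = Matrix.fromBlocks
          (Matrix.of fun i j : Fin b =>
            z (q i : Fin (b + a)) ^ (nu' j + (b : ℤ) - 1 - (j : ℤ))) 0 0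
          (Matrix.of fun i j : Fin a =>
            z (p i : Fin (b + a)) ^ (mu j + (a : ℤ) - 1 - (j : ℤ))) := by
    ext (i | i) (j | j)
    · simp [hgl, hnu j j.2, hnu' j j.2]
      congr 1
      ring
    · simp [hgl]
    · simp [hgr, hp]
    · simp [hgr, hp, hmu j j.2]
      congr 1
      ring
  rw [hM, hV, Matrix.det_fromBlocks_zero₂₁]
  simp only [div_eq_mul_inv, mul_inv]
  ring

open Classical in
/-- the general shuffle formula (symmetric-function form of the
Józefiak–Lascoux–Pragacz pushforward formula). -/
theorem statement9 (N k1 k2 : ℕ)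
    (m1 : Fin k1 → ℕ) (m2 : Fin k2 → ℕ)
    (h1 : StrictAnti m1) (h2 : StrictAnti m2)
    (h12 : ∀ (j : Fin k2) (j' : Fin k1), m1 j' < m2 j)
    (Z1 : Fin k1 → Finset (Fin N)) (Z2 : Fin k2 → Finset (Fin N))
    (hdisj : ∀ s t : Fin k1 ⊕ Fin k2, s ≠ t →
      Disjoint (Sum.elim Z1 Z2 s) (Sum.elim Z1 Z2 t))
    (hcover : Finset.univ.biUnion (Sum.elim Z1 Z2) = Finset.univ) :
    schur (Finset.univ : Finset (Fin N))
        (padded ((List.ofFn fun j : Fin k2 =>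
            List.replicate (Z2 j).card
              ((m2 j : ℤ) - k1 - k2 + 1 + (j : ℤ))).flatten ++
          (List.ofFn fun j : Fin k1 =>
            List.replicate (Z1 j).card
              ((m1 j : ℤ) - k1 + 1 + (j : ℤ))).flatten))
      = ∑ P ∈ Finset.univ.filter (fun P : Finset (Fin N) × Finset (Fin N) =>
            P.1.card = (Finset.univ.biUnion Z1).card ∧
            P.2.card = (Finset.univ.biUnion Z2).card ∧
            Disjoint P.1 P.2 ∧ P.1 ∪ P.2 = Finset.univ),
          (zsub P.2 P.1)⁻¹ *
            schur P.1
              (padded (List.ofFn fun j : Fin k1 =>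
                List.replicate (Z1 j).card
                  ((m1 j : ℤ) - k1 + 1 + (j : ℤ))).flatten) *
            schur P.2
              (padded (List.ofFn fun j : Fin k2 =>
                List.replicate (Z2 j).card
                  ((m2 j : ℤ) + ((Finset.univ.biUnion Z1).card : ℤ) - k1 - k2 + 1 +
                    (j : ℤ))).flatten) := by
  have d1 : (Finset.univ.biUnion Z1).card = ∑ j, (Z1 j).card := by
    refine Finset.card_biUnion fun i _ j _ hij => ?_
    simpa using hdisj (Sum.inl i) (Sum.inl j) (by simpa using hij)
  have d2 : (Finset.univ.biUnion Z2).card = ∑ j, (Z2 j).card := by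
    refine Finset.card_biUnion fun i _ j _ hij => ?_
    simpa using hdisj (Sum.inr i) (Sum.inr j) (by simpa using hij)
  have hN : N = (Finset.univ.biUnion Z2).card + (Finset.univ.biUnion Z1).card := by
    have h := congrArg Finset.card hcover
    rw [Finset.card_biUnion fun s _ t _ hst => hdisj s t hst, Fintype.sum_sum_type] at h
    simp only [Sum.elim_inl, Sum.elim_inr, Finset.card_univ, Fintype.card_fin] at h
    rw [d1, d2]
    omega
  have hlen {k : ℕ} (c : Fin k → ℕ) (x : Fin k → ℤ) :
      (List.ofFn fun j => List.replicate (c j) (x j)).flatten.length = ∑ j, c j := by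
    simp [List.length_flatten, List.map_ofFn, List.sum_ofFn, Function.comp_def]
  have hshift : (List.ofFn fun j : Fin k2 => List.replicate (Z2 j).card
        ((m2 j : ℤ) + ((Finset.univ.biUnion Z1).card : ℤ) - k1 - k2 + 1 + (j : ℤ))).flatten =
      (List.ofFn fun j : Fin k2 => List.replicate (Z2 j).card
        ((m2 j : ℤ) - k1 - k2 + 1 + (j : ℤ))).flatten.map
          (· + ((Finset.univ.biUnion Z1).card : ℤ)) := by
    simp only [List.map_flatten, List.map_ofFn, Function.comp_def, List.map_replicate]
    congr 3
    ext1 j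
    congr 1
    ring
  rw [hshift]
  have hl1 := hlen (fun j => (Z1 j).card) fun j => (m1 j : ℤ) - k1 + 1 + (j : ℤ)
  have hl2 := hlen (fun j => (Z2 j).card) fun j => (m2 j : ℤ) - k1 - k2 + 1 + (j : ℤ)
  rw [← d1] at hl1
  rw [← d2] at hl2
  refine schur_univ_eq_sum hN _ _ _ (nu := padded (List.ofFn fun j : Fin k2 =>
    List.replicate (Z2 j).card ((m2 j : ℤ) - k1 - k2 + 1 + (j : ℤ))).flatten)
    (fun j hj => ?_) (fun j hj => ?_) (fun j hj => ?_)
  · exact List.getD_append _ _ _ _ (by rwa [hl2])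
  · rw [padded, List.getD_append_right _ _ _ _ (by omega), hl2, Nat.add_sub_cancel_left]
    rfl
  · simp only [padded]
    rw [List.getD_eq_getElem _ _ (by rwa [List.length_map, hl2]),
      List.getD_eq_getElem _ _ (by rwa [hl2]), List.getElem_map]

end
end

section
/- With the q-oscillator operators on V = (ℕ×ℕ×ℕ) →₀ K and X₁(z) := a⁺₁₂a⁻₁₁k₂₁ + z·a⁺₁₂k₂₁ + k₁₁k₂₁, one has X₁(z) ∘ X₁(w) = X₁(w) ∘ X₁(z) for all z, w ∈ K. -/
noncomputable section

variable (K : Type*) [Field K]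

/-- The vector space with basis `|a,b,c⟩`, `a,b,c ∈ ℕ`. -/
abbrev V := (ℕ × ℕ × ℕ) →₀ K

/-- The basis vector `|a,b,c⟩`. -/
noncomputable def bs (p : ℕ × ℕ × ℕ) : V K := Finsupp.single p 1

/-- The linear operator determined by its values on the basis vectors. -/
noncomputable def opOf (g : ℕ × ℕ × ℕ → V K) : V K →ₗ[K] V K :=
  Finsupp.linearCombination K g

variable {K} (q : K)

noncomputable def ap11 : V K →ₗ[K] V K := opOf K fun p => bs K (p.1 + 1, p.2.1, p.2.2)
noncomputable def am11 : V K →ₗ[K] V K :=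
  opOf K fun p => (1 - q ^ (2 * p.1)) • bs K (p.1 - 1, p.2.1, p.2.2)
noncomputable def k11 : V K →ₗ[K] V K := opOf K fun p => q ^ p.1 • bs K p
noncomputable def ap12 : V K →ₗ[K] V K := opOf K fun p => bs K (p.1, p.2.1 + 1, p.2.2)
noncomputable def am12 : V K →ₗ[K] V K :=
  opOf K fun p => (1 - q ^ (2 * p.2.1)) • bs K (p.1, p.2.1 - 1, p.2.2)
noncomputable def k12 : V K →ₗ[K] V K := opOf K fun p => q ^ p.2.1 • bs K p
noncomputable def ap21 : V K →ₗ[K] V K := opOf K fun p => bs K (p.1, p.2.1, p.2.2 + 1)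
noncomputable def am21 : V K →ₗ[K] V K :=
  opOf K fun p => (1 - q ^ (2 * p.2.2)) • bs K (p.1, p.2.1, p.2.2 - 1)
noncomputable def k21 : V K →ₗ[K] V K := opOf K fun p => q ^ p.2.2 • bs K p

/-- `X₁(z) = a⁺₁₂a⁻₁₁k₂₁ + z·a⁺₁₂k₂₁ + k₁₁k₂₁`. -/
noncomputable def X1 (z : K) : V K →ₗ[K] V K :=
  ap12 ∘ₗ am11 q ∘ₗ k21 q + z • (ap12 ∘ₗ k21 q) + k11 q ∘ₗ k21 q


theorem opOf_bs (g : ℕ × ℕ × ℕ → V K) (p : ℕ × ℕ × ℕ) : opOf K g (bs K p) = g p := by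
  simp [opOf, bs]

theorem linearMap_ext_bs {f g : V K →ₗ[K] V K} (h : ∀ p, f (bs K p) = g (bs K p)) : f = g :=
  Finsupp.lhom_ext' fun p => LinearMap.ext_ring (h p)

theorem X1_bs (z : K) (a b c : ℕ) :
    X1 q z (bs K (a, b, c)) =
      (q ^ c * (1 - q ^ (2 * a))) • bs K (a - 1, b + 1, c) + (z * q ^ c) • bs K (a, b + 1, c) +
        (q ^ c * q ^ a) • bs K (a, b, c) := by
  simp [X1, ap12, am11, k11, k21, opOf_bs, smul_smul]

/-- the operators `X₁(z)` commute: `X₁(z) ∘ X₁(w) = X₁(w) ∘ X₁(z)`. -/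
theorem statement16 (z w : K) : (X1 q z) ∘ₗ (X1 q w) = (X1 q w) ∘ₗ (X1 q z) := by
  refine linearMap_ext_bs fun ⟨a, b, c⟩ => ?_
  simp only [LinearMap.comp_apply, X1_bs, map_add, map_smul]
  module

end
end

section
/- With the q-oscillator operators on V = (ℕ×ℕ×ℕ) →₀ K and X₀(z) := 1 + z·a⁺₁₁ + z²·a⁺₁₂a⁺₂₁ + z·a⁺₁₂a⁺₂₁a⁻₁₁ − qz·a⁺₁₂k₁₁ + z·a⁺₂₁k₁₁, one has X₀(z) ∘ X₀(w) = X₀(w) ∘ X₀(z) for all z, w ∈ K. -/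
noncomputable section

variable (K : Type*) [Field K]

variable {K} (q : K)

/-- `X₀(z) = 1 + z·a⁺₁₁ + z²·a⁺₁₂a⁺₂₁ + z·a⁺₁₂a⁺₂₁a⁻₁₁ − qz·a⁺₁₂k₁₁ + z·a⁺₂₁k₁₁`. -/
noncomputable def X0 (z : K) : V K →ₗ[K] V K :=
  LinearMap.id + z • ap11 + z ^ 2 • (ap12 ∘ₗ ap21) + z • (ap12 ∘ₗ ap21 ∘ₗ am11 q)
    - (q * z) • (ap12 ∘ₗ k11 q) + z • (ap21 ∘ₗ k11 q)

@[simp] lemma opOf_single (g : ℕ × ℕ × ℕ → V K) (p : ℕ × ℕ × ℕ) :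
    opOf K g (Finsupp.single p 1) = g p := by
  simp [opOf]

lemma commute_ap12_ap21 : Commute (ap12 : Module.End K (V K)) ap21 := by
  refine Finsupp.lhom_ext' fun p => LinearMap.ext_ring ?_
  simp [ap12, ap21, bs]

lemma commute_ap11_ap12 : Commute (ap11 : Module.End K (V K)) ap12 := by
  refine Finsupp.lhom_ext' fun p => LinearMap.ext_ring ?_
  simp [ap11, ap12, bs]

lemma commute_ap11_ap21 : Commute (ap11 : Module.End K (V K)) ap21 := by
  refine Finsupp.lhom_ext' fun p => LinearMap.ext_ring ?_
  simp [ap11, ap21, bs]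

lemma commute_am11_ap12 : Commute (am11 q : Module.End K (V K)) ap12 := by
  refine Finsupp.lhom_ext' fun p => LinearMap.ext_ring ?_
  simp [am11, ap12, bs, -Finsupp.smul_single]

lemma commute_am11_ap21 : Commute (am11 q : Module.End K (V K)) ap21 := by
  refine Finsupp.lhom_ext' fun p => LinearMap.ext_ring ?_
  simp [am11, ap21, bs, -Finsupp.smul_single]

lemma commute_k11_ap12 : Commute (k11 q : Module.End K (V K)) ap12 := by
  refine Finsupp.lhom_ext' fun p => LinearMap.ext_ring ?_
  simp [k11, ap12, bs, -Finsupp.smul_single]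

lemma commute_k11_ap21 : Commute (k11 q : Module.End K (V K)) ap21 := by
  refine Finsupp.lhom_ext' fun p => LinearMap.ext_ring ?_
  simp [k11, ap21, bs, -Finsupp.smul_single]

/-- The coefficient of `z` in `X₀(z)`. -/
def X0Linear : Module.End K (V K) :=
  ap11 + ap12 * (ap21 * am11 q) - q • (ap12 * k11 q) + ap21 * k11 q

lemma X0_eq (z : K) :
    X0 q z = (1 + z • X0Linear q + z ^ 2 • (ap12 * ap21) : Module.End K (V K)) := by
  simp only [X0, X0Linear, Module.End.mul_eq_comp, Module.End.one_eq_id]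
  module

lemma commute_X0Linear : Commute (X0Linear q) (ap12 * ap21) := by
  have hb : Commute (X0Linear q) ap12 := by
    refine Commute.add_left (R := Module.End K (V K)) (Commute.sub_left (R := Module.End K (V K))
      (Commute.add_left (R := Module.End K (V K)) commute_ap11_ap12 ?_)
      (Commute.smul_left ?_ q)) ?_
    · exact (Commute.refl _).mul_left (commute_ap12_ap21.symm.mul_left (commute_am11_ap12 q))
    · exact (Commute.refl _).mul_left (commute_k11_ap12 q)
    · exact commute_ap12_ap21.symm.mul_left (commute_k11_ap12 q)
  have hc : Commute (X0Linear q) ap21 := by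
    refine Commute.add_left (R := Module.End K (V K)) (Commute.sub_left (R := Module.End K (V K))
      (Commute.add_left (R := Module.End K (V K)) commute_ap11_ap21 ?_)
      (Commute.smul_left ?_ q)) ?_
    · exact commute_ap12_ap21.mul_left ((Commute.refl _).mul_left (commute_am11_ap21 q))
    · exact commute_ap12_ap21.mul_left (commute_k11_ap21 q)
    · exact (Commute.refl _).mul_left (commute_k11_ap21 q)
  exact hb.mul_right hc

/-- Quadratic polynomials in commuting coefficients commute. -/
lemma Commute.one_add_smul_add_smul {R A : Type*} [CommRing R] [Ring A] [Algebra R A] {a b : A}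
    (h : Commute a b) (z z' w w' : R) :
    Commute (1 + z • a + z' • b) (1 + w • a + w' • b) := by
  have ha : Commute a (1 + w • a + w' • b) :=
    ((Commute.one_right a).add_right ((Commute.refl a).smul_right w)).add_right (h.smul_right w')
  have hb : Commute b (1 + w • a + w' • b) :=
    ((Commute.one_right b).add_right (h.symm.smul_right w)).add_right
      ((Commute.refl b).smul_right w')
  exact ((Commute.one_left _).add_left (ha.smul_left z)).add_left (hb.smul_left z')

/-- the operators `X₀(z)` commute: `X₀(z) ∘ X₀(w) = X₀(w) ∘ X₀(z)`. -/
theorem statement17 (z w : K) : (X0 q z) ∘ₗ (X0 q w) = (X0 q w) ∘ₗ (X0 q z) := by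
  rw [X0_eq, X0_eq]
  exact Commute.one_add_smul_add_smul (A := Module.End K (V K)) (commute_X0Linear q) z (z ^ 2) w (w ^ 2)

end
end

section
/- Let m₁₁, m₁₂, m₂₁ ∈ ℕ, let z_1,…,z_a ∈ K be nonzero and w_1,…,w_b ∈ K. Then the coefficient of the basis vector |m₁₁,m₁₂,m₂₁⟩ in X₃(z_1) ∘ ⋯ ∘ X₃(z_a) ∘ X₁(w_1) ∘ ⋯ ∘ X₁(w_b) applied to |m₁₁,m₁₂,m₂₁⟩ equals q^{(m₁₁+m₂₁)·b} · Σ_{i=0}^{min(a,b)} [∏_{p=1}^{i} (1 − q^{2(m₁₂+p)})] · e_i(z_1^{-1},…,z_a^{-1}) · e_i(w_1,…,w_b), where e_i denotes the i-th elementary symmetric polynomial. -/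
noncomputable section

variable (K : Type*) [Field K]

variable {K} (q : K)

/-- `X₃(z) = 1 + z⁻¹·a⁺₁₁a⁻₁₂a⁻₂₁ + z⁻¹·a⁻₁₁ + z⁻²·a⁻₁₂a⁻₂₁ + z⁻¹·a⁻₁₂k₁₁ − qz⁻¹·a⁻₂₁k₁₁`. -/
noncomputable def X3 (z : K) : V K →ₗ[K] V K :=
  LinearMap.id + z⁻¹ • (ap11 ∘ₗ am12 q ∘ₗ am21 q) + z⁻¹ • am11 q
    + (z⁻¹) ^ 2 • (am12 q ∘ₗ am21 q) + z⁻¹ • (am12 q ∘ₗ k11 q)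
    - (q * z⁻¹) • (am21 q ∘ₗ k11 q)

/-- The `i`-th elementary symmetric polynomial evaluated at `x_1,…,x_n`. -/
noncomputable def esymm {n : ℕ} (i : ℕ) (x : Fin n → K) : K :=
  ∑ S ∈ Finset.powersetCard i (Finset.univ : Finset (Fin n)), ∏ j ∈ S, x j

/-! ### Coordinates of the operators -/

theorem linearMap_eq_of_bs {M : Type*} [AddCommMonoid M] [Module K M] {f g : V K →ₗ[K] M}
    (h : ∀ x y w, f (bs K (x, y, w)) = g (bs K (x, y, w))) (v : V K) : f v = g v := by
  have : f = g := Finsupp.lhom_ext' fun p => LinearMap.ext_ring (h p.1 p.2.1 p.2.2)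
  rw [this]

theorem bs_apply (p r : ℕ × ℕ × ℕ) : bs K p r = if p = r then 1 else 0 := by
  simp [bs, Finsupp.single_apply]

theorem am11_apply (v : V K) (a n c : ℕ) :
    am11 q v (a, n, c) = (1 - q ^ (2 * (a + 1))) * v (a + 1, n, c) := by
  refine linearMap_eq_of_bs (f := Finsupp.lapply (a, n, c) ∘ₗ am11 q)
    (g := (1 - q ^ (2 * (a + 1))) • Finsupp.lapply (a + 1, n, c)) (fun x y w => ?_) v
  rcases x with _ | x
  · simp [am11, opOf_bs, bs_apply]
  · by_cases h : x = a <;> simp [am11, opOf_bs, bs_apply, h]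

theorem am12_apply (v : V K) (a n c : ℕ) :
    am12 q v (a, n, c) = (1 - q ^ (2 * (n + 1))) * v (a, n + 1, c) := by
  refine linearMap_eq_of_bs (f := Finsupp.lapply (a, n, c) ∘ₗ am12 q)
    (g := (1 - q ^ (2 * (n + 1))) • Finsupp.lapply (a, n + 1, c)) (fun x y w => ?_) v
  rcases y with _ | y
  · simp [am12, opOf_bs, bs_apply]
  · by_cases h : y = n <;> simp [am12, opOf_bs, bs_apply, h]

theorem am21_apply (v : V K) (a n c : ℕ) :
    am21 q v (a, n, c) = (1 - q ^ (2 * (c + 1))) * v (a, n, c + 1) := by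
  refine linearMap_eq_of_bs (f := Finsupp.lapply (a, n, c) ∘ₗ am21 q)
    (g := (1 - q ^ (2 * (c + 1))) • Finsupp.lapply (a, n, c + 1)) (fun x y w => ?_) v
  rcases w with _ | w
  · simp [am21, opOf_bs, bs_apply]
  · by_cases h : w = c <;> simp [am21, opOf_bs, bs_apply, h]

theorem k11_apply (v : V K) (a n c : ℕ) : k11 q v (a, n, c) = q ^ a * v (a, n, c) := by
  refine linearMap_eq_of_bs (f := Finsupp.lapply (a, n, c) ∘ₗ k11 q)
    (g := q ^ a • Finsupp.lapply (a, n, c)) (fun x y w => ?_) v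
  by_cases h : x = a <;> simp [k11, opOf_bs, bs_apply, h]

theorem k21_apply (v : V K) (a n c : ℕ) : k21 q v (a, n, c) = q ^ c * v (a, n, c) := by
  refine linearMap_eq_of_bs (f := Finsupp.lapply (a, n, c) ∘ₗ k21 q)
    (g := q ^ c • Finsupp.lapply (a, n, c)) (fun x y w => ?_) v
  by_cases h : w = c <;> simp [k21, opOf_bs, bs_apply, h]

theorem ap11_apply_zero (v : V K) (n c : ℕ) : ap11 v (0, n, c) = 0 :=
  linearMap_eq_of_bs (f := Finsupp.lapply (0, n, c) ∘ₗ ap11) (g := 0)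
    (fun x y w => by simp [ap11, opOf_bs, bs_apply]) v

theorem ap11_apply_succ (v : V K) (a n c : ℕ) : ap11 v (a + 1, n, c) = v (a, n, c) :=
  linearMap_eq_of_bs (f := Finsupp.lapply (a + 1, n, c) ∘ₗ ap11) (g := Finsupp.lapply (a, n, c))
    (fun x y w => by simp [ap11, opOf_bs, bs_apply]) v

theorem ap12_apply_zero (v : V K) (a c : ℕ) : ap12 v (a, 0, c) = 0 :=
  linearMap_eq_of_bs (f := Finsupp.lapply (a, 0, c) ∘ₗ ap12) (g := 0)
    (fun x y w => by simp [ap12, opOf_bs, bs_apply]) v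

theorem ap12_apply_succ (v : V K) (a n c : ℕ) : ap12 v (a, n + 1, c) = v (a, n, c) :=
  linearMap_eq_of_bs (f := Finsupp.lapply (a, n + 1, c) ∘ₗ ap12) (g := Finsupp.lapply (a, n, c))
    (fun x y w => by simp [ap12, opOf_bs, bs_apply]) v

theorem X1_apply_zero (z : K) (v : V K) (a c : ℕ) :
    X1 q z v (a, 0, c) = q ^ (a + c) * v (a, 0, c) := by
  simp [X1, ap12_apply_zero, k11_apply, k21_apply, pow_add, mul_assoc]

theorem X1_apply_succ (z : K) (v : V K) (a n c : ℕ) :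
    X1 q z v (a, n + 1, c) =
      q ^ c * ((1 - q ^ (2 * (a + 1))) * v (a + 1, n, c) + z * v (a, n, c)
        + q ^ a * v (a, n + 1, c)) := by
  simp only [X1, LinearMap.add_apply, LinearMap.smul_apply, LinearMap.comp_apply,
    Finsupp.add_apply, Finsupp.smul_apply, smul_eq_mul, ap12_apply_succ, am11_apply, k11_apply,
    k21_apply]
  ring

/-! ### Vectors supported below a leading pair of indices -/

/-- `v` involves only basis vectors `|a,n,c⟩` with `(c, a)` lexicographically at most `(c₀, a₀)`. -/
def SupportedBelow (a₀ c₀ : ℕ) (v : V K) : Prop :=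
  ∀ a n c, c₀ < c ∨ c = c₀ ∧ a₀ < a → v (a, n, c) = 0

theorem supportedBelow_bs (a n c : ℕ) : SupportedBelow a c (bs K (a, n, c)) := by
  intro x y w h
  rw [bs_apply, if_neg]
  simp only [Prod.mk.injEq]
  omega

namespace SupportedBelow

variable {q} {a₀ c₀ : ℕ} {v : V K}

theorem X1 (h : SupportedBelow a₀ c₀ v) (z : K) : SupportedBelow a₀ c₀ (X1 q z v) := by
  intro a n c hc
  rcases n with _ | n
  · rw [X1_apply_zero, h _ _ _ hc, mul_zero]
  · rw [X1_apply_succ, h _ _ _ hc, h _ _ _ hc, h (a + 1) n c (by omega)]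
    ring

theorem X3 (h : SupportedBelow a₀ c₀ v) (z : K) : SupportedBelow a₀ c₀ (X3 q z v) := by
  intro a n c hc
  have h1 : ∀ n, v (a, n, c) = 0 := fun n => h _ _ _ hc
  have h2 : ∀ n, v (a + 1, n, c) = 0 := fun n => h _ _ _ (by omega)
  have h3 : ∀ a n, v (a, n, c + 1) = 0 := fun a n => h _ _ _ (by omega)
  rcases a with _ | a <;>
  simp [_root_.X3, ap11_apply_zero, ap11_apply_succ, am11_apply, am12_apply, am21_apply,
    k11_apply, h1, h2, h3]

theorem X1_apply_succ (h : SupportedBelow a₀ c₀ v) (z : K) (n : ℕ) :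
    _root_.X1 q z v (a₀, n + 1, c₀) =
      q ^ c₀ * (z * v (a₀, n, c₀) + q ^ a₀ * v (a₀, n + 1, c₀)) := by
  rw [_root_.X1_apply_succ, h (a₀ + 1) n c₀ (by omega)]
  ring

theorem X3_apply (h : SupportedBelow a₀ c₀ v) (z : K) (n : ℕ) :
    _root_.X3 q z v (a₀, n, c₀) =
      v (a₀, n, c₀) + z⁻¹ * q ^ a₀ * (1 - q ^ (2 * (n + 1))) * v (a₀, n + 1, c₀) := by
  have h2 : ∀ n, v (a₀ + 1, n, c₀) = 0 := fun n => h _ _ _ (by omega)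
  have h3 : ∀ a n, v (a, n, c₀ + 1) = 0 := fun a n => h _ _ _ (by omega)
  rcases a₀ with _ | a <;>
  simp [_root_.X3, ap11_apply_zero, ap11_apply_succ, am11_apply, am12_apply, am21_apply,
    k11_apply, h2, h3] <;>
  ring

end SupportedBelow

/-! ### Elementary symmetric polynomials of lists -/

theorem esymm_eq_multiset_esymm {n : ℕ} (i : ℕ) (x : Fin n → K) :
    esymm i x = Multiset.esymm (List.ofFn x : Multiset K) i := by
  rw [← Fin.univ_val_map, Finset.esymm_map_val, esymm]

theorem multiset_esymm_zero (s : Multiset K) : s.esymm 0 = 1 := by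
  simp [Multiset.esymm]

theorem multiset_esymm_cons_succ (x : K) (s : Multiset K) (i : ℕ) :
    (x ::ₘ s).esymm (i + 1) = s.esymm (i + 1) + x * s.esymm i := by
  simp [Multiset.esymm, Multiset.powersetCard_cons, Multiset.sum_map_mul_left]

theorem multiset_esymm_eq_zero {s : Multiset K} {i : ℕ} (h : s.card < i) : s.esymm i = 0 := by
  simp [Multiset.esymm, Multiset.powersetCard_eq_empty _ h]

/-! ### Coordinates of products of the operators -/

theorem prod_X1_bs (m11 m12 m21 : ℕ) (l : List K) :
    SupportedBelow m11 m21 ((l.map (X1 q)).prod (bs K (m11, m12, m21))) ∧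
      (∀ n < m12, (l.map (X1 q)).prod (bs K (m11, m12, m21)) (m11, n, m21) = 0) ∧
      ∀ i, (q ^ m11) ^ i * (l.map (X1 q)).prod (bs K (m11, m12, m21)) (m11, m12 + i, m21) =
        q ^ ((m11 + m21) * l.length) * (l : Multiset K).esymm i := by
  induction l with
  | nil =>
    refine ⟨supportedBelow_bs _ _ _, fun n hn => ?_, fun i => ?_⟩
    · simp [bs_apply, hn.ne']
    · rcases i with _ | i
      · simp [bs_apply, multiset_esymm_zero]
      · rw [multiset_esymm_eq_zero (by simp)]
        simp [bs_apply]
  | cons w l ih =>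
    simp only [List.map_cons, List.prod_cons, Module.End.mul_apply, List.length_cons]
    generalize (l.map (X1 q)).prod (bs K (m11, m12, m21)) = v at ih
    obtain ⟨hv, h0, hi⟩ := ih
    refine ⟨hv.X1 w, fun n hn => ?_, fun i => ?_⟩
    · rcases n with _ | n
      · rw [X1_apply_zero, h0 _ hn, mul_zero]
      · rw [hv.X1_apply_succ, h0 _ hn, h0 n (by omega)]
        ring
    · rw [← Multiset.cons_coe]
      rcases i with _ | i
      · have h := hi 0
        simp only [pow_zero, one_mul, add_zero, multiset_esymm_zero, mul_one] at h ⊢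
        rcases m12 with _ | m
        · rw [X1_apply_zero, h]
          ring
        · rw [hv.X1_apply_succ, h, h0 m (by omega)]
          ring
      · rw [← add_assoc, hv.X1_apply_succ, multiset_esymm_cons_succ]
        have h1 := hi (i + 1)
        rw [← add_assoc] at h1
        linear_combination q ^ (m11 + m21) * h1 + q ^ (m11 + m21) * w * hi i

theorem prod_X3_apply {m11 m21 : ℕ} {v : V K} (hv : SupportedBelow m11 m21 v) (l : List K) :
    SupportedBelow m11 m21 ((l.map (X3 q)).prod v) ∧
      ∀ n, (l.map (X3 q)).prod v (m11, n, m21) =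
        ∑ i ∈ Finset.range (l.length + 1),
          (∏ p ∈ Finset.range i, (1 - q ^ (2 * (n + p + 1)))) *
            (l.map (·⁻¹) : Multiset K).esymm i * ((q ^ m11) ^ i * v (m11, n + i, m21)) := by
  induction l with
  | nil => exact ⟨hv, fun n => by simp [multiset_esymm_zero]⟩
  | cons z l ih =>
    simp only [List.map_cons, List.prod_cons, Module.End.mul_apply, List.length_cons]
    obtain ⟨hs, hn⟩ := ih
    refine ⟨hs.X3 z, fun n => ?_⟩
    rw [hs.X3_apply, ← Multiset.cons_coe, Finset.sum_range_succ', hn (n + 1), Finset.mul_sum]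
    have key : (l.map (X3 q)).prod v (m11, n, m21) =
        ∑ i ∈ Finset.range (l.length + 1 + 1),
          (∏ p ∈ Finset.range i, (1 - q ^ (2 * (n + p + 1)))) *
            (l.map (·⁻¹) : Multiset K).esymm i * ((q ^ m11) ^ i * v (m11, n + i, m21)) := by
      rw [Finset.sum_range_succ, hn, multiset_esymm_eq_zero (i := l.length + 1) (by simp)]
      ring
    rw [key, Finset.sum_range_succ', add_right_comm, ← Finset.sum_add_distrib]
    congr 1
    · refine Finset.sum_congr rfl fun i _ => ?_
      rw [multiset_esymm_cons_succ, Finset.prod_range_succ']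
      have hp : ∀ p, n + 1 + p + 1 = n + (p + 1) + 1 := fun p => by ring
      simp only [hp, add_assoc n 1 i, add_comm 1 i]
      ring
    · simp [multiset_esymm_zero]

/-- the diagonal matrix element
`⟨m₁₁,m₁₂,m₂₁| X₃(z_1)⋯X₃(z_a) X₁(w_1)⋯X₁(w_b) |m₁₁,m₁₂,m₂₁⟩`. -/
theorem statement18 (a b : ℕ) (zs : Fin a → K) (hz : ∀ t, zs t ≠ 0) (ws : Fin b → K)
    (m11 m12 m21 : ℕ) :
    (((List.ofFn fun t : Fin a => (X3 q (zs t) : Module.End K (V K))) ++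
        (List.ofFn fun t : Fin b => (X1 q (ws t) : Module.End K (V K)))).prod
      (bs K (m11, m12, m21))) (m11, m12, m21)
      = q ^ ((m11 + m21) * b) *
        ∑ i ∈ Finset.range (min a b + 1),
          (∏ p ∈ Finset.range i, (1 - q ^ (2 * (m12 + p + 1)))) *
            esymm i (fun t => (zs t)⁻¹) * esymm i ws := by
  have hX1 : (List.ofFn fun t : Fin b => (X1 q (ws t) : Module.End K (V K))) =
      (List.ofFn ws).map (X1 q) := (List.map_ofFn (f := ws) (g := X1 q)).symm
  have hX3 : (List.ofFn fun t : Fin a => (X3 q (zs t) : Module.End K (V K))) =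
      (List.ofFn zs).map (X3 q) := (List.map_ofFn (f := zs) (g := X3 q)).symm
  have hinv : (List.ofFn zs).map (·⁻¹) = List.ofFn fun t => (zs t)⁻¹ := List.map_ofFn ..
  obtain ⟨hv, -, hi⟩ := prod_X1_bs q m11 m12 m21 (List.ofFn ws)
  rw [List.prod_append, Module.End.mul_apply, hX1, hX3, (prod_X3_apply q hv (List.ofFn zs)).2 m12,
    hinv, Finset.mul_sum]
  simp only [hi, List.length_ofFn, ← esymm_eq_multiset_esymm]
  symm
  refine Finset.sum_subset_zero_on_sdiff (Finset.range_mono (by omega)) (fun i h => ?_)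
    fun i _ => by ring
  simp only [Finset.mem_sdiff, Finset.mem_range] at h
  rw [esymm_eq_multiset_esymm i ws, multiset_esymm_eq_zero (by simp; omega)]
  ring

end
end
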